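/- arXiv:2007.01036 — 7 statements merged into one kernel-verified Lean document; each statement's English description precedes it below -/
import Mathlib

section
/- Let u ∈ Ω be an admissible ten-moment state and let f : Ω → ℝ⁶ be the x-direction flux of the ten-moment Gaussian closure system. Then the entropy pair (U, F), with U(u) = -ρ ln(det p/ρ⁴) and F(u) = -ρ v^x ln(det p/ρ⁴), satisfies the compatibility relation ∇F(u) = (Df(u))ᵀ ∇U(u), where Df(u) is the Jacobian of f with respect to the conservative variables and the gradients are taken with respect to the conservative variables. -/
/-!
Ten-moment Gaussian closure equations: basic definitions.
Conservative state `u = (ρ, mˣ, mʸ, Eˣˣ, Eˣʸ, Eʸʸ) ∈ ℝ⁶`.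
-/

noncomputable section

namespace TenMoment

/-- The space of conservative variables: vectors in `ℝ⁶`. -/
abbrev St : Type := Fin 6 → ℝ

/-- Density `ρ`. -/
def rho (u : St) : ℝ := u 0
/-- Velocity `vˣ = mˣ/ρ`. -/
def vx (u : St) : ℝ := u 1 / u 0
/-- Velocity `vʸ = mʸ/ρ`. -/
def vy (u : St) : ℝ := u 2 / u 0
/-- Pressure component `pˣˣ = Eˣˣ - ρ vˣ vˣ`. -/
def pxx (u : St) : ℝ := u 3 - rho u * vx u * vx u
/-- Pressure component `pˣʸ = Eˣʸ - ρ vˣ vʸ`. -/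
def pxy (u : St) : ℝ := u 4 - rho u * vx u * vy u
/-- Pressure component `pʸʸ = Eʸʸ - ρ vʸ vʸ`. -/
def pyy (u : St) : ℝ := u 5 - rho u * vy u * vy u
/-- The symmetric 2×2 pressure tensor. -/
def pmat (u : St) : Matrix (Fin 2) (Fin 2) ℝ := !![pxx u, pxy u; pxy u, pyy u]
/-- `det p`. -/
def detp (u : St) : ℝ := pxx u * pyy u - pxy u * pxy u

/-- The admissible set `Ω`: positive density and positive definite pressure tensor. -/
def admissible (u : St) : Prop := 0 < rho u ∧ (pmat u).PosDef

/-- Entropy `U(u) = -ρ ln (det p / ρ⁴)`. -/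
def entU (u : St) : ℝ := - rho u * Real.log (detp u / (rho u) ^ 4)
/-- Entropy flux (x-direction) `F(u) = -ρ vˣ ln (det p / ρ⁴)`. -/
def entF (u : St) : ℝ := - rho u * vx u * Real.log (detp u / (rho u) ^ 4)
/-- Entropy flux (y-direction) `G(u) = -ρ vʸ ln (det p / ρ⁴)`. -/
def entG (u : St) : ℝ := - rho u * vy u * Real.log (detp u / (rho u) ^ 4)

/-- The x-direction flux of the ten-moment system. -/
def fluxF (u : St) : St :=
  ![rho u * vx u,
    rho u * vx u ^ 2 + pxx u,
    rho u * vx u * vy u + pxy u,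
    rho u * vx u ^ 3 + 3 * vx u * pxx u,
    rho u * vx u ^ 2 * vy u + 2 * vx u * pxy u + vy u * pxx u,
    rho u * vx u * vy u ^ 2 + vx u * pyy u + 2 * vy u * pxy u]

/-- The y-direction flux of the ten-moment system. -/
def fluxG (u : St) : St :=
  ![rho u * vy u,
    rho u * vx u * vy u + pxy u,
    rho u * vy u ^ 2 + pyy u,
    rho u * vy u * vx u ^ 2 + vy u * pxx u + 2 * vx u * pxy u,
    rho u * vy u ^ 2 * vx u + 2 * vy u * pxy u + vx u * pyy u,
    rho u * vy u ^ 3 + 3 * vy u * pyy u]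

/-- The gradient of the entropy `U` with respect to the conservative variables
(the entropy variable `v(u) = ∇ᵤ U(u)`). -/
def gradU (u : St) : St := fun i => fderiv ℝ entU u (Pi.single i 1)

/-- Euclidean dot product on `ℝ⁶`. -/
def dot (a b : St) : ℝ := ∑ i, a i * b i

/-- The x-direction source term, for a pointwise value `Wx` of `∂ₓW`. -/
def srcX (Wx : ℝ) (u : St) : St :=
  ![0, -(1/2) * rho u * Wx, 0, -(rho u * vx u * Wx), -(1/2) * rho u * vy u * Wx, 0]

/-- The y-direction source term, for a pointwise value `Wy` of `∂_y W`. -/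
def srcY (Wy : ℝ) (u : St) : St :=
  ![0, 0, -(1/2) * rho u * Wy, 0, -(1/2) * rho u * vx u * Wy, -(rho u * vy u * Wy)]

/-- The x-direction entropy potential `ψ(u) = v(u)·f(u) - F(u)`. -/
def psiX (u : St) : ℝ := dot (gradU u) (fluxF u) - entF u

/-- The Jacobian `Df(u)` of the x-direction flux with respect to the conservative variables. -/
def jacF (u : St) : Matrix (Fin 6) (Fin 6) ℝ :=
  fun i j => fderiv ℝ (fun w => fluxF w i) u (Pi.single j 1)

/-- The boundary coefficients `τ₀ = -1`, `τ_k = 1`, `τ_j = 0` otherwise. -/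
def tau (k : ℕ) : Fin (k+1) → ℝ :=
  fun j => if (j : ℕ) = 0 then -1 else if (j : ℕ) = k then 1 else 0

/-- The logarithmic mean: `(b-a)/(ln b - ln a)` for `a ≠ b`, and `a` when `a = b`. -/
def logMean (a b : ℝ) : ℝ := if a = b then a else (b - a) / (Real.log b - Real.log a)

/-- The arithmetic mean. -/
def avg (a b : ℝ) : ℝ := (a + b) / 2

/-- Auxiliary variable `D = det p / ρ`. -/
def Dq (u : St) : ℝ := detp u / rho u
/-- `β_{xx} = pˣˣ/D`. -/
def bxx (u : St) : ℝ := pxx u / Dq u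
/-- `β_{xy} = pˣʸ/D`. -/
def bxy (u : St) : ℝ := pxy u / Dq u
/-- `β_{yy} = pʸʸ/D`. -/
def byy (u : St) : ℝ := pyy u / Dq u
/-- `D_β = β_{xx} β_{yy} - β_{xy}²`. -/
def Db (u : St) : ℝ := bxx u * byy u - bxy u ^ 2

/-- The entropy conservative two-point flux of Sen–Kumar for the x-direction. -/
def fstarEC (uL uR : St) : St :=
  let rln := logMean (rho uL) (rho uR)
  let vxb := avg (vx uL) (vx uR)
  let vyb := avg (vy uL) (vy uR)
  let rb := avg (rho uL) (rho uR)
  let bxxb := avg (bxx uL) (bxx uR)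
  let bxyb := avg (bxy uL) (bxy uR)
  let byyb := avg (byy uL) (byy uR)
  let Dbln := logMean (Db uL) (Db uR)
  let vx2b := avg (vx uL ^ 2) (vx uR ^ 2)
  let vy2b := avg (vy uL ^ 2) (vy uR ^ 2)
  let vxyb := avg (vx uL * vy uL) (vx uR * vy uR)
  let f1 := rln * vxb
  let f2 := f1 * vxb + rb * bxxb / (bxxb * byyb - bxyb ^ 2)
  let f3 := f1 * vyb + rb * bxyb / (bxxb * byyb - bxyb ^ 2)
  ![f1, f2, f3,
    (bxxb / Dbln - vx2b) * f1 + 2 * vxb * f2,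
    (bxyb / Dbln - vxyb) * f1 + vxb * f3 + vyb * f2,
    (byyb / Dbln - vy2b) * f1 + 2 * vyb * f3]

end TenMoment


namespace TenMoment

/-- Coordinate projection. -/
abbrev dd (i : Fin 6) : St →L[ℝ] ℝ := ContinuousLinearMap.proj i

lemma hasFDerivAt_coord (u : St) (i : Fin 6) : HasFDerivAt (fun w : St => w i) (dd i) u :=
  (dd i).hasFDerivAt

lemma hasFDerivAt_rho (u : St) : HasFDerivAt rho (dd 0) u := hasFDerivAt_coord u 0

lemma hasFDerivAt_vx (u : St) (h : rho u ≠ 0) :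
    HasFDerivAt vx ((rho u)⁻¹ • (dd 1 - vx u • dd 0)) u := by
  have h0 : u 0 ≠ 0 := h
  have := (hasFDerivAt_coord u 1).mul (((hasDerivAt_inv h0).comp_hasFDerivAt u (hasFDerivAt_coord u 0)))
  refine (this.congr_fderiv ?_)
  ext k
  simp [vx, rho]
  field_simp
  try ring

lemma hasFDerivAt_vy (u : St) (h : rho u ≠ 0) :
    HasFDerivAt vy ((rho u)⁻¹ • (dd 2 - vy u • dd 0)) u := by
  have h0 : u 0 ≠ 0 := h
  have := (hasFDerivAt_coord u 2).mul (((hasDerivAt_inv h0).comp_hasFDerivAt u (hasFDerivAt_coord u 0)))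
  refine (this.congr_fderiv ?_)
  ext k
  simp [vy, rho]
  field_simp
  try ring

lemma hasFDerivAt_pxx (u : St) (h : rho u ≠ 0) :
    HasFDerivAt pxx (dd 3 - (2 * vx u) • dd 1 + (vx u * vx u) • dd 0) u := by
  have := (hasFDerivAt_coord u 3).sub
    (((hasFDerivAt_rho u).mul (hasFDerivAt_vx u h)).mul (hasFDerivAt_vx u h))
  refine (this.congr_fderiv ?_)
  apply ContinuousLinearMap.ext
  intro k
  simp
  field_simp
  try ring

lemma hasFDerivAt_pxy (u : St) (h : rho u ≠ 0) :
    HasFDerivAt pxy (dd 4 - vx u • dd 2 - vy u • dd 1 + (vx u * vy u) • dd 0) u := by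
  have := (hasFDerivAt_coord u 4).sub
    (((hasFDerivAt_rho u).mul (hasFDerivAt_vx u h)).mul (hasFDerivAt_vy u h))
  refine (this.congr_fderiv ?_)
  apply ContinuousLinearMap.ext
  intro k
  simp
  field_simp
  try ring

lemma hasFDerivAt_pyy (u : St) (h : rho u ≠ 0) :
    HasFDerivAt pyy (dd 5 - (2 * vy u) • dd 2 + (vy u * vy u) • dd 0) u := by
  have := (hasFDerivAt_coord u 5).sub
    (((hasFDerivAt_rho u).mul (hasFDerivAt_vy u h)).mul (hasFDerivAt_vy u h))
  refine (this.congr_fderiv ?_)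
  apply ContinuousLinearMap.ext
  intro k
  simp
  field_simp
  try ring

/-- Derivative of `det p`. -/
def ddet (u : St) : St →L[ℝ] ℝ :=
  pxx u • (dd 5 - (2 * vy u) • dd 2 + (vy u * vy u) • dd 0)
  + pyy u • (dd 3 - (2 * vx u) • dd 1 + (vx u * vx u) • dd 0)
  - (2 * pxy u) • (dd 4 - vx u • dd 2 - vy u • dd 1 + (vx u * vy u) • dd 0)

lemma hasFDerivAt_detp (u : St) (h : rho u ≠ 0) : HasFDerivAt detp (ddet u) u := by
  have := ((hasFDerivAt_pxx u h).mul (hasFDerivAt_pyy u h)).sub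
    ((hasFDerivAt_pxy u h).mul (hasFDerivAt_pxy u h))
  refine (this.congr_fderiv ?_)
  apply ContinuousLinearMap.ext
  intro k
  simp [ddet]
  ring

/-- The specific entropy. -/
def ls (u : St) : ℝ := Real.log (detp u / (rho u) ^ 4)

lemma hasFDerivAt_ls (u : St) (h : rho u ≠ 0) (hd : detp u ≠ 0) :
    HasFDerivAt ls ((detp u)⁻¹ • ddet u - (4 * (rho u)⁻¹) • dd 0) u := by
  have := (((hasFDerivAt_detp u h).mul
    ((hasDerivAt_inv (pow_ne_zero 4 h)).comp_hasFDerivAt u ((hasFDerivAt_rho u).pow 4)))).log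
      (mul_ne_zero hd (inv_ne_zero (pow_ne_zero 4 h)))
  refine (this.congr_fderiv ?_)
  apply ContinuousLinearMap.ext
  intro k
  simp
  field_simp
  try ring

lemma hasFDerivAt_entU (u : St) (h : rho u ≠ 0) (hd : detp u ≠ 0) :
    HasFDerivAt entU (-(ls u • dd 0) - rho u • ((detp u)⁻¹ • ddet u - (4 * (rho u)⁻¹) • dd 0)) u := by
  have := (hasFDerivAt_rho u).neg.mul (hasFDerivAt_ls u h hd)
  refine (this.congr_fderiv ?_)
  apply ContinuousLinearMap.ext
  intro k
  simp
  ring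

lemma hasFDerivAt_entF (u : St) (h : rho u ≠ 0) (hd : detp u ≠ 0) :
    HasFDerivAt entF (-(ls u • dd 1)
      - (rho u * vx u) • ((detp u)⁻¹ • ddet u - (4 * (rho u)⁻¹) • dd 0)) u := by
  have := ((hasFDerivAt_rho u).neg.mul (hasFDerivAt_vx u h)).mul (hasFDerivAt_ls u h hd)
  refine (this.congr_fderiv ?_)
  apply ContinuousLinearMap.ext
  intro k
  simp
  field_simp
  ring

/-- Derivative of the flux, componentwise. -/
def dflux (u : St) : Fin 6 → (St →L[ℝ] ℝ) :=
  let A := (rho u)⁻¹ • (dd 1 - vx u • dd 0)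
  let B := (rho u)⁻¹ • (dd 2 - vy u • dd 0)
  let P := dd 3 - (2 * vx u) • dd 1 + (vx u * vx u) • dd 0
  let Q := dd 4 - vx u • dd 2 - vy u • dd 1 + (vx u * vy u) • dd 0
  ![dd 1, dd 3, dd 4,
    (3 * vx u ^ 2) • dd 1 - (2 * vx u ^ 3) • dd 0 + (3 * vx u) • P + (3 * pxx u) • A,
    (2 * vx u * vy u) • dd 1 + vx u ^ 2 • dd 2 - (2 * vx u ^ 2 * vy u) • dd 0
      + (2 * vx u) • Q + (2 * pxy u) • A + vy u • P + pxx u • B,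
    (vy u ^ 2) • dd 1 + (2 * vx u * vy u) • dd 2 - (2 * vx u * vy u ^ 2) • dd 0
      + vx u • (dd 5 - (2 * vy u) • dd 2 + (vy u * vy u) • dd 0) + pyy u • A
      + (2 * vy u) • Q + (2 * pxy u) • B]

lemma hasFDerivAt_fluxF (u : St) (h : rho u ≠ 0) :
    HasFDerivAt fluxF (ContinuousLinearMap.pi (dflux u)) u := by
  have hr := hasFDerivAt_rho u
  have ha := hasFDerivAt_vx u h
  have hb := hasFDerivAt_vy u h
  have hP := hasFDerivAt_pxx u h
  have hQ := hasFDerivAt_pxy u h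
  have hR := hasFDerivAt_pyy u h
  rw [hasFDerivAt_pi']
  intro i
  fin_cases i
  · refine (hr.mul ha).congr_fderiv ?_
    apply ContinuousLinearMap.ext
    intro k
    simp [dflux]
    field_simp
    try ring
  · refine ((hr.mul (ha.pow 2)).add hP).congr_fderiv ?_
    apply ContinuousLinearMap.ext
    intro k
    simp [dflux]
    field_simp
    try ring
  · refine (((hr.mul ha).mul hb).add hQ).congr_fderiv ?_
    apply ContinuousLinearMap.ext
    intro k
    simp [dflux]
    field_simp
    try ring
  · refine ((hr.mul (ha.pow 3)).add ((ha.const_mul 3).mul hP)).congr_fderiv ?_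
    apply ContinuousLinearMap.ext
    intro k
    simp [dflux]
    field_simp
    try ring
  · refine ((((hr.mul (ha.pow 2)).mul hb).add ((ha.const_mul 2).mul hQ)).add
      (hb.mul hP)).congr_fderiv ?_
    apply ContinuousLinearMap.ext
    intro k
    simp [dflux]
    field_simp
    try ring
  · refine ((((hr.mul ha).mul (hb.pow 2)).add (ha.mul hR)).add
      ((hb.const_mul 2).mul hQ)).congr_fderiv ?_
    apply ContinuousLinearMap.ext
    intro k
    simp [dflux]
    field_simp
    try ring

end TenMoment

open TenMoment in
/-- For an admissible state `u ∈ Ω`, the entropy pair `(U, F)` for the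
x-direction flux `f` satisfies the compatibility relation `F'(u) = U'(u) ∘ f'(u)`,
i.e. `∇F(u) = (Df(u))ᵀ ∇U(u)`. -/
theorem tenMoment_entropy_flux_compatibility_x (u : St) (hu : admissible u) :
    fderiv ℝ entF u = (fderiv ℝ entU u).comp (fderiv ℝ fluxF u) := by
  have h : rho u ≠ 0 := hu.1.ne'
  have hd : detp u ≠ 0 := by
    have := hu.2.det_pos
    rw [pmat, Matrix.det_fin_two_of] at this
    exact this.ne'
  rw [(hasFDerivAt_entF u h hd).fderiv, (hasFDerivAt_entU u h hd).fderiv,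
    (hasFDerivAt_fluxF u h).fderiv]
  apply ContinuousLinearMap.ext
  intro k
  simp [dflux, ddet]
  field_simp
  simp only [detp]
  ring
end
end

section
/- The function U(u) = -ρ ln(det p/ρ⁴), viewed as a function of the conservative ten-moment variables u = (ρ, m^x, m^y, E^{xx}, E^{xy}, E^{yy}), is convex on the admissible set Ω. -/
/-!
Ten-moment Gaussian closure equations: basic definitions.
Conservative state `u = (ρ, mˣ, mʸ, Eˣˣ, Eˣʸ, Eʸʸ) ∈ ℝ⁶`.
-/

noncomputable section

namespace TenMoment

lemma adm_iff (u : St) : admissible u ↔ 0 < u 0 ∧ ∀ x y : ℝ, (x ≠ 0 ∨ y ≠ 0) →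
    0 < pxx u * x ^ 2 + 2 * pxy u * x * y + pyy u * y ^ 2 := by
  unfold admissible rho
  refine and_congr_right fun _ => ?_
  rw [Matrix.posDef_iff_dotProduct_mulVec]
  constructor
  · rintro ⟨-, h⟩ x y hxy
    have hne : (![x, y] : Fin 2 → ℝ) ≠ 0 := by
      intro h0
      have h1 := congrFun h0 0
      have h2 := congrFun h0 1
      simp at h1 h2
      tauto
    have := h hne
    simp [pmat, Matrix.mulVec, dotProduct, Fin.sum_univ_two] at this
    nlinarith
  · intro h
    refine ⟨?_, ?_⟩
    · ext i j
      fin_cases i <;> fin_cases j <;> simp [pmat]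
    · intro z hz
      have hne : z 0 ≠ 0 ∨ z 1 ≠ 0 := by
        by_contra hc
        push Not at hc
        apply hz
        ext i
        fin_cases i <;> simp [hc.1, hc.2]
      have := h (z 0) (z 1) hne
      simp [pmat, Matrix.mulVec, dotProduct, Fin.sum_univ_two]
      nlinarith

/-- Scalar consequences of admissibility. -/
lemma adm_pos {u : St} (h : admissible u) :
    0 < u 0 ∧ 0 < pxx u ∧ 0 < pyy u ∧ 0 < detp u := by
  obtain ⟨h0, hq⟩ := (adm_iff u).1 h
  have h1 := hq 1 0 (by simp)
  have h2 := hq 0 1 (by simp)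
  have h1' : 0 < pxx u := by linarith
  have h3 := hq (-pxy u) (pxx u) (Or.inr h1'.ne')
  refine ⟨h0, h1', by linarith, ?_⟩
  have : 0 < pxx u * detp u := by unfold detp; nlinarith
  exact (mul_pos_iff_of_pos_left h1').1 this

lemma shift_xx (u : St) (h : u 0 ≠ 0) (k : ℝ) :
    u 3 - 2 * u 1 * k + u 0 * k ^ 2 = pxx u + u 0 * (vx u - k) ^ 2 := by
  unfold pxx vx rho; field_simp; ring

lemma shift_xy (u : St) (h : u 0 ≠ 0) (k l : ℝ) :
    u 4 - u 1 * l - u 2 * k + u 0 * k * l = pxy u + u 0 * (vx u - k) * (vy u - l) := by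
  unfold pxy vx vy rho; field_simp; ring

lemma shift_yy (u : St) (h : u 0 ≠ 0) (l : ℝ) :
    u 5 - 2 * u 2 * l + u 0 * l ^ 2 = pyy u + u 0 * (vy u - l) ^ 2 := by
  unfold pyy vy rho; field_simp; ring

lemma adm_convex : Convex ℝ {u : St | admissible u} := by
  intro u hu w hw a b ha hb hab
  obtain ⟨hu0, hu⟩ := (adm_iff u).1 hu
  obtain ⟨hw0, hw⟩ := (adm_iff w).1 hw
  refine (adm_iff _).2 ?_
  set z : St := a • u + b • w with hz
  have hzi : ∀ i, z i = a * u i + b * w i := fun i => by simp [hz]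
  have comb : ∀ s t : ℝ, 0 < s → 0 < t → 0 < a * s + b * t := by
    intro s t hs ht
    rcases ha.eq_or_lt with h | h
    · have : b = 1 := by linarith
      subst this; rw [← h]; linarith
    · have := mul_pos h hs
      have := mul_nonneg hb ht.le
      linarith
  have hz0 : 0 < z 0 := by rw [hzi]; exact comb _ _ hu0 hw0
  refine ⟨hz0, fun x y hxy => ?_⟩
  have e1 := shift_xx z hz0.ne' (vx z)
  have e2 := shift_xy z hz0.ne' (vx z) (vy z)
  have e3 := shift_yy z hz0.ne' (vy z)
  have u1 := shift_xx u hu0.ne' (vx z)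
  have u2 := shift_xy u hu0.ne' (vx z) (vy z)
  have u3 := shift_yy u hu0.ne' (vy z)
  have w1 := shift_xx w hw0.ne' (vx z)
  have w2 := shift_xy w hw0.ne' (vx z) (vy z)
  have w3 := shift_yy w hw0.ne' (vy z)
  have pu : 0 < (pxx u * x ^ 2 + 2 * pxy u * x * y + pyy u * y ^ 2)
      + u 0 * ((vx u - vx z) * x + (vy u - vy z) * y) ^ 2 :=
    add_pos_of_pos_of_nonneg (hu x y hxy) (by positivity)
  have pw : 0 < (pxx w * x ^ 2 + 2 * pxy w * x * y + pyy w * y ^ 2)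
      + w 0 * ((vx w - vx z) * x + (vy w - vy z) * y) ^ 2 :=
    add_pos_of_pos_of_nonneg (hw x y hxy) (by positivity)
  have key := comb _ _ pu pw
  simp only [hzi] at e1 e2 e3
  have f1 : pxx z = a * (pxx u + u 0 * (vx u - vx z) ^ 2)
      + b * (pxx w + w 0 * (vx w - vx z) ^ 2) := by
    rw [← u1, ← w1]; linear_combination -e1
  have f2 : pxy z = a * (pxy u + u 0 * (vx u - vx z) * (vy u - vy z))
      + b * (pxy w + w 0 * (vx w - vx z) * (vy w - vy z)) := by
    rw [← u2, ← w2]; linear_combination -e2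
  have f3 : pyy z = a * (pyy u + u 0 * (vy u - vy z) ^ 2)
      + b * (pyy w + w 0 * (vy w - vy z) ^ 2) := by
    rw [← u3, ← w3]; linear_combination -e3
  have : pxx z * x ^ 2 + 2 * pxy z * x * y + pyy z * y ^ 2 =
      a * ((pxx u * x ^ 2 + 2 * pxy u * x * y + pyy u * y ^ 2)
      + u 0 * ((vx u - vx z) * x + (vy u - vy z) * y) ^ 2)
      + b * ((pxx w * x ^ 2 + 2 * pxy w * x * y + pyy w * y ^ 2)
      + w 0 * ((vx w - vx z) * x + (vy w - vy z) * y) ^ 2) := by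
    linear_combination x ^ 2 * f1 + 2 * x * y * f2 + y ^ 2 * f3
  rw [this]; exact key

/-- The supporting affine function of the entropy at `w`, evaluated at `u`. -/
def supp (w u : St) : ℝ :=
  -u 0 * Real.log (detp w / w 0 ^ 4) + 4 * u 0 - 2 * w 0
    - w 0 / detp w * (pyy w * (u 3 - 2 * u 1 * vx w + u 0 * vx w ^ 2)
      - 2 * pxy w * (u 4 - u 1 * vy w - u 2 * vx w + u 0 * vx w * vy w)
      + pxx w * (u 5 - 2 * u 2 * vy w + u 0 * vy w ^ 2))

lemma supp_self {w : St} (hw : admissible w) : supp w w = entU w := by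
  obtain ⟨h0, -, -, hd⟩ := adm_pos hw
  unfold supp
  rw [shift_xx w h0.ne', shift_xy w h0.ne', shift_yy w h0.ne']
  have : w 0 / detp w * (2 * detp w) = 2 * w 0 := by field_simp
  have e : pyy w * (pxx w + w 0 * (vx w - vx w) ^ 2)
      - 2 * pxy w * (pxy w + w 0 * (vx w - vx w) * (vy w - vy w))
      + pxx w * (pyy w + w 0 * (vy w - vy w) ^ 2) = 2 * detp w := by
    unfold detp; ring
  rw [e, this]
  unfold entU rho; ring

lemma log_bound {r q D d s : ℝ} (hr : 0 < r) (hq : 0 < q) (hD : 0 < D) (hd : 0 < d)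
    (hs : 0 < s) (h : 4 * D * d ≤ s ^ 2) :
    q * Real.log (d / q ^ 4) ≤ q * Real.log (D / r ^ 4) - 4 * q + 2 * r + r / D * s := by
  have hx : 0 < s * r / (2 * D * q) := by positivity
  have hy : 0 < r / q := by positivity
  have h1 := Real.log_le_sub_one_of_pos hx
  have h2 := Real.log_le_sub_one_of_pos hy
  have h3 : d / q ^ 4 ≤ D / r ^ 4 * ((s * r / (2 * D * q)) ^ 2 * (r / q) ^ 2) := by
    have : D / r ^ 4 * ((s * r / (2 * D * q)) ^ 2 * (r / q) ^ 2) = (s ^ 2 / (4 * D)) / q ^ 4 := by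
      field_simp; ring
    rw [this]
    gcongr
    rw [le_div_iff₀ (by positivity)]; linarith
  have h4 := Real.log_le_log (by positivity) h3
  rw [Real.log_mul (by positivity) (by positivity), Real.log_mul (by positivity) (by positivity),
    Real.log_pow, Real.log_pow] at h4
  push_cast at h4
  have h5 : Real.log (d / q ^ 4) ≤ Real.log (D / r ^ 4)
      + (2 * (s * r / (2 * D * q) - 1) + 2 * (r / q - 1)) := by linarith
  have h6 := mul_le_mul_of_nonneg_left h5 hq.le
  have e : q * (Real.log (D / r ^ 4) + (2 * (s * r / (2 * D * q) - 1) + 2 * (r / q - 1)))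
      = q * Real.log (D / r ^ 4) - 4 * q + 2 * r + r / D * s := by
    field_simp; ring
  linarith

lemma supp_le {w u : St} (hw : admissible w) (hu : admissible u) : supp w u ≤ entU u := by
  obtain ⟨w0, wx, wy, wd⟩ := adm_pos hw
  obtain ⟨u0, ux, uy, ud⟩ := adm_pos hu
  have hd1 : pxy w ^ 2 < pxx w * pyy w := by unfold detp at wd; nlinarith
  have hd2 : pxy u ^ 2 < pxx u * pyy u := by unfold detp at ud; nlinarith
  have hform : ∀ X Y : ℝ, 0 ≤ pyy w * X ^ 2 - 2 * pxy w * X * Y + pxx w * Y ^ 2 := by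
    intro X Y
    have : 0 ≤ pyy w * (pyy w * X ^ 2 - 2 * pxy w * X * Y + pxx w * Y ^ 2) := by
      nlinarith [sq_nonneg (pyy w * X - pxy w * Y), mul_nonneg (sub_nonneg.2 hd1.le) (sq_nonneg Y)]
    exact nonneg_of_mul_nonneg_right this wy
  set s := pyy w * pxx u - 2 * pxy w * pxy u + pxx w * pyy u with hs
  have hs0 : 0 < s := by
    have : 0 < pxx u * s := by
      have h1 := hform (pxx u) (pxy u)
      have h2 := mul_pos wx (sub_pos.2 hd2)
      rw [hs]; nlinarith
    exact (mul_pos_iff_of_pos_left ux).1 this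
  have hsq : 4 * detp w * detp u ≤ s ^ 2 := by
    -- discriminant of the quadratic form `det (p u + t p w)` in `t`, whose value at
    -- `t = -pxx u / pxx w` is nonpositive
    have id : pxx w ^ 2 * (s ^ 2 - 4 * detp w * detp u) =
        (pxx w * s - 2 * pxx u * detp w) ^ 2
          + 4 * detp w * (pxx w * pxy u - pxx u * pxy w) ^ 2 := by
      rw [hs]; unfold detp; ring
    have : 0 ≤ pxx w ^ 2 * (s ^ 2 - 4 * detp w * detp u) := by rw [id]; positivity
    have := nonneg_of_mul_nonneg_right this (by positivity)
    linarith
  have hlog := log_bound w0 u0 wd ud hs0 hsq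
  unfold supp
  rw [shift_xx u u0.ne', shift_xy u u0.ne', shift_yy u u0.ne']
  have e : pyy w * (pxx u + u 0 * (vx u - vx w) ^ 2)
      - 2 * pxy w * (pxy u + u 0 * (vx u - vx w) * (vy u - vy w))
      + pxx w * (pyy u + u 0 * (vy u - vy w) ^ 2) =
      s + u 0 * (pyy w * (vx u - vx w) ^ 2 - 2 * pxy w * (vx u - vx w) * (vy u - vy w)
        + pxx w * (vy u - vy w) ^ 2) := by
    rw [hs]; ring
  rw [e, mul_add]
  have h7 := mul_nonneg (div_pos w0 wd).le
    (mul_nonneg u0.le (hform (vx u - vx w) (vy u - vy w)))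
  unfold entU rho
  linarith

lemma supp_comb (w u v : St) (a b : ℝ) (hab : a + b = 1) :
    supp w (a • u + b • v) = a * supp w u + b * supp w v := by
  have hb : b = 1 - a := by linarith
  subst hb
  simp only [supp, Pi.add_apply, Pi.smul_apply, smul_eq_mul]
  ring

end TenMoment

open TenMoment in
/-- The entropy `U(u) = -ρ ln(det p / ρ⁴)` is convex on the admissible set `Ω`. -/
theorem tenMoment_entropy_convex :
    ConvexOn ℝ {u : St | admissible u} entU := by
  refine ⟨adm_convex, ?_⟩
  intro u hu v hv a b ha hb hab
  have hz := adm_convex hu hv ha hb hab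
  rw [← supp_self hz, supp_comb _ _ _ _ _ hab]
  exact add_le_add (mul_le_mul_of_nonneg_left (supp_le hz hu) ha)
    (mul_le_mul_of_nonneg_left (supp_le hz hv) hb)
end
end

section
/- For every u ∈ Ω and all real numbers W_x, W_y, the entropy variable v(u) = ∇_u U(u) is orthogonal to the ten-moment source vectors: v(u) · s^x(u) = 0 and v(u) · s^y(u) = 0, where s^x(u) = (0, -½ρW_x, 0, -ρ v^x W_x, -½ρ v^y W_x, 0) and s^y(u) = (0, 0, -½ρW_y, 0, -½ρ v^x W_y, -ρ v^y W_y). -/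
/-!
Ten-moment Gaussian closure equations: basic definitions.
Conservative state `u = (ρ, mˣ, mʸ, Eˣˣ, Eˣʸ, Eʸʸ) ∈ ℝ⁶`.
-/

noncomputable section

namespace TenMoment

/-- The dot product with the gradient is the directional derivative. -/
lemma dot_gradU (u s : St) : dot (gradU u) s = fderiv ℝ entU u s := by
  have h : s = ∑ i, s i • (Pi.single i (1 : ℝ) : St) := by
    simpa using (pi_eq_sum_univ' s)
  conv_rhs => rw [h]
  simp only [map_sum, map_smul, smul_eq_mul, dot, gradU]
  exact Finset.sum_congr rfl fun i _ => mul_comm _ _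

/-- If `entU` is constant along a parabola through `u` with tangent `s`, the directional
derivative vanishes. -/
lemma fderiv_eq_zero_of_curve (u s r : St)
    (h : ∀ t : ℝ, entU (u + t • s + t ^ 2 • r) = entU u) : fderiv ℝ entU u s = 0 := by
  by_cases hd : DifferentiableAt ℝ entU u
  · have hg : HasDerivAt (fun t : ℝ => u + t • s + t ^ 2 • r) s 0 := by
      have h1 := ((hasDerivAt_id (0 : ℝ)).smul_const s).const_add u
      have h2 := ((hasDerivAt_id (0 : ℝ)).pow 2).smul_const r
      have h3 := h1.add h2
      have h4 : (1 : ℝ) • s + ((2 : ℕ) * id (0 : ℝ) ^ (2 - 1) * 1) • r = s := by simp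
      rw [h4] at h3
      exact h3
    have hd' : HasFDerivAt entU (fderiv ℝ entU u) (u + (0 : ℝ) • s + (0 : ℝ) ^ 2 • r) := by
      simpa using hd.hasFDerivAt
    have hc := hd'.comp_hasDerivAt (0 : ℝ) hg
    have he : (entU ∘ fun t : ℝ => u + t • s + t ^ 2 • r) = fun _ => entU u := funext h
    rw [he] at hc
    exact hc.unique (hasDerivAt_const _ _)
  · simp [fderiv_zero_of_not_differentiableAt hd]

/-- The entropy only depends on density and pressure. -/
lemma entU_congr (u w : St) (h0 : rho w = rho u) (h1 : pxx w = pxx u) (h2 : pxy w = pxy u)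
    (h3 : pyy w = pyy u) : entU w = entU u := by
  simp only [entU, detp, h0, h1, h2, h3]

end TenMoment

open TenMoment in
/-- For every `u ∈ Ω` and all `Wx, Wy ∈ ℝ`, the entropy variable
`v(u) = ∇ᵤU(u)` is orthogonal to the ten-moment source vectors `sˣ(u)` and `sʸ(u)`. -/
theorem tenMoment_source_entropy_orthogonal (u : St) (hu : admissible u) (Wx Wy : ℝ) :
    dot (gradU u) (srcX Wx u) = 0 ∧ dot (gradU u) (srcY Wy u) = 0 := by
  have h0 : u 0 ≠ 0 := hu.1.ne'
  rw [dot_gradU, dot_gradU]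
  constructor
  · apply fderiv_eq_zero_of_curve u _ ![0, 0, 0, rho u * Wx ^ 2 / 4, 0, 0]
    intro t
    apply entU_congr <;>
      simp only [pxx, pxy, pyy, rho, vx, vy, srcX, Pi.add_apply, Pi.smul_apply, smul_eq_mul] <;>
      simp <;> (try field_simp) <;> (try ring)
  · apply fderiv_eq_zero_of_curve u _ ![0, 0, 0, 0, 0, rho u * Wy ^ 2 / 4]
    intro t
    apply entU_congr <;>
      simp only [pxx, pxy, pyy, rho, vx, vy, srcY, Pi.add_apply, Pi.smul_apply, smul_eq_mul] <;>
      simp <;> (try field_simp) <;> (try ring)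
end
end

section
/- Let u ∈ Ω be an admissible ten-moment state and let Df(u) be the 6×6 Jacobian of the x-direction ten-moment flux f with respect to the conservative variables. Then the characteristic polynomial of Df(u) is (λ - v^x)² ((λ - v^x)² - 3p^{xx}/ρ) ((λ - v^x)² - p^{xx}/ρ); in particular the eigenvalues of Df(u) are v^x (with algebraic multiplicity two), v^x ± √(3p^{xx}/ρ), and v^x ± √(p^{xx}/ρ), each of the latter four with multiplicity one. -/
/-!
Ten-moment Gaussian closure equations: basic definitions.
Conservative state `u = (ρ, mˣ, mʸ, Eˣˣ, Eˣʸ, Eʸʸ) ∈ ℝ⁶`.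
-/

noncomputable section

namespace TenMoment

set_option linter.unusedSimpArgs false
set_option maxHeartbeats 4000000

theorem det_aux {R : Type*} [CommRing R] (x p q r s t y z k l d e g m : R) :
    (!![x, -1, 0, 0, 0, 0; 0, x, 0, -1, 0, 0; 0, 0, x, 0, -1, 0;
        -p, -q, 0, x - r, 0, 0; -s, -t, -y, -z, x - k, 0;
        -l, -d, -e, 0, -g, x - m] : Matrix (Fin 6) (Fin 6) R).det =
      (x - m) * (x * (x * (x - r) - q) - p) * (x * (x - k) - y) := by
  rw [Matrix.det_succ_column _ 5]
  simp only [Fin.sum_univ_six]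
  simp [Matrix.det_succ_row_zero, Fin.sum_univ_succ, Matrix.submatrix_apply, Fin.succAbove]
  ring

open Polynomial in
theorem charpoly_aux (v w a b c : ℝ) :
    (!![0, 1, 0, 0, 0, 0;
        0, 0, 0, 1, 0, 0;
        0, 0, 0, 0, 1, 0;
        4 * v ^ 3 - 3 * v * a, 3 * a - 6 * v ^ 2, 0, 3 * v, 0, 0;
        4 * v ^ 2 * w - 2 * v * b - w * a, 2 * b - 4 * v * w, a - 2 * v ^ 2, w, 2 * v, 0;
        4 * v * w ^ 2 - v * c - 2 * w * b, c - 2 * w ^ 2, 2 * b - 4 * v * w, 0, 2 * w, v]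
      : Matrix (Fin 6) (Fin 6) ℝ).charpoly =
      (X - C v) ^ 2 * ((X - C v) ^ 2 - C (3 * (a - v ^ 2)))
        * ((X - C v) ^ 2 - C (a - v ^ 2)) := by
  have h3 : (C 3 : ℝ[X]) = 3 := rfl
  have h2 : (C 2 : ℝ[X]) = 2 := rfl
  have h4 : (C 4 : ℝ[X]) = 4 := rfl
  have h6 : (C 6 : ℝ[X]) = 6 := rfl
  rw [Matrix.charpoly]
  have : ∀ M : Matrix (Fin 6) (Fin 6) ℝ, M.charmatrix =
      Matrix.of fun i j => (if i = j then (X : ℝ[X]) else 0) - C (M i j) := by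
    intro M; ext1 i j; simp [Matrix.charmatrix_apply, Matrix.diagonal_apply]
  have hM : ∀ p q r s t y z k l : ℝ, ∀ d e g : ℝ,
      (Matrix.of fun i j => (if i = j then (X : ℝ[X]) else 0) -
        C ((!![0, 1, 0, 0, 0, 0; 0, 0, 0, 1, 0, 0; 0, 0, 0, 0, 1, 0;
          p, q, 0, r, 0, 0; s, t, y, z, k, 0; l, d, e, 0, g, v] :
            Matrix (Fin 6) (Fin 6) ℝ) i j)) =
      !![X, -1, 0, 0, 0, 0; 0, X, 0, -1, 0, 0; 0, 0, X, 0, -1, 0;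
          -C p, -C q, 0, X - C r, 0, 0; -C s, -C t, -C y, -C z, X - C k, 0;
          -C l, -C d, -C e, 0, -C g, X - C v] := by
    intros
    ext1 i j
    fin_cases i <;> fin_cases j <;> simp
  rw [this, hM, det_aux]
  simp only [map_sub, map_mul, map_pow, h2, h3, h4, h6]
  ring

theorem jacF_eq (u : St) (h : u 0 ≠ 0) (v w a b c : ℝ) (hv : v = u 1 / u 0) (hw : w = u 2 / u 0)
    (ha : a = u 3 / u 0) (hb : b = u 4 / u 0) (hc : c = u 5 / u 0) :
    jacF u = !![0, 1, 0, 0, 0, 0;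
        0, 0, 0, 1, 0, 0;
        0, 0, 0, 0, 1, 0;
        4 * v ^ 3 - 3 * v * a, 3 * a - 6 * v ^ 2, 0, 3 * v, 0, 0;
        4 * v ^ 2 * w - 2 * v * b - w * a, 2 * b - 4 * v * w, a - 2 * v ^ 2, w, 2 * v, 0;
        4 * v * w ^ 2 - v * c - 2 * w * b, c - 2 * w ^ 2, 2 * b - 4 * v * w, 0, 2 * w, v] := by
  have p : ∀ k : Fin 6, HasFDerivAt (fun z : St => z k) (ContinuousLinearMap.proj (R := ℝ) (φ := fun _ : Fin 6 => ℝ) k) u :=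
    fun k => hasFDerivAt_apply k u
  have hr : HasFDerivAt rho _ u := p 0
  have hi : HasFDerivAt (fun z : St => (z 0)⁻¹) _ u := (hasDerivAt_inv h).comp_hasFDerivAt u (p 0)
  have hx : HasFDerivAt vx _ u := (p 1).mul hi
  have hy : HasFDerivAt vy _ u := (p 2).mul hi
  have hxx : HasFDerivAt pxx _ u := (p 3).sub ((hr.mul hx).mul hx)
  have hxy : HasFDerivAt pxy _ u := (p 4).sub ((hr.mul hx).mul hy)
  have hyy : HasFDerivAt pyy _ u := (p 5).sub ((hr.mul hy).mul hy)
  have f0 : HasFDerivAt (fun z => fluxF z 0) _ u := hr.mul hx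
  have f1 : HasFDerivAt (fun z => fluxF z 1) _ u := (hr.mul (hx.pow 2)).add hxx
  have f2 : HasFDerivAt (fun z => fluxF z 2) _ u := ((hr.mul hx).mul hy).add hxy
  have f3 : HasFDerivAt (fun z => fluxF z 3) _ u := (hr.mul (hx.pow 3)).add ((hx.const_mul 3).mul hxx)
  have f4 : HasFDerivAt (fun z => fluxF z 4) _ u :=
    (((hr.mul (hx.pow 2)).mul hy).add ((hx.const_mul 2).mul hxy)).add (hy.mul hxx)
  have f5 : HasFDerivAt (fun z => fluxF z 5) _ u :=
    (((hr.mul hx).mul (hy.pow 2)).add (hx.mul hyy)).add ((hy.const_mul 2).mul hxy)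
  subst hv hw ha hb hc
  ext i j
  fin_cases i
  · simp only [jacF, Fin.zero_eta, f0.fderiv]
    fin_cases j <;> simp [rho, vx, vy, pxx, pxy, pyy, Pi.single_apply] <;> (try field_simp) <;> (try ring)
  · simp only [jacF, Fin.mk_one, f1.fderiv]
    fin_cases j <;> simp [rho, vx, vy, pxx, pxy, pyy, Pi.single_apply] <;> (try field_simp) <;> (try ring)
  · simp only [jacF, Fin.reduceFinMk, f2.fderiv]
    fin_cases j <;> simp [rho, vx, vy, pxx, pxy, pyy, Pi.single_apply] <;> (try field_simp) <;> (try ring)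
  · simp only [jacF, Fin.reduceFinMk, f3.fderiv]
    fin_cases j <;> simp [rho, vx, vy, pxx, pxy, pyy, Pi.single_apply] <;> (try field_simp) <;> (try ring)
  · simp only [jacF, Fin.reduceFinMk, f4.fderiv]
    fin_cases j <;> simp [rho, vx, vy, pxx, pxy, pyy, Pi.single_apply] <;> (try field_simp) <;> (try ring)
  · simp only [jacF, Fin.reduceFinMk, f5.fderiv]
    fin_cases j <;> simp [rho, vx, vy, pxx, pxy, pyy, Pi.single_apply] <;> (try field_simp) <;> (try ring)

end TenMoment

open TenMoment Polynomial in
/-- For `u ∈ Ω`, the characteristic polynomial of the flux Jacobian `Df(u)` is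
`(λ - vˣ)² ((λ - vˣ)² - 3pˣˣ/ρ) ((λ - vˣ)² - pˣˣ/ρ)`; in particular the eigenvalues of `Df(u)`
are `vˣ` (multiplicity two), `vˣ ± √(3pˣˣ/ρ)` and `vˣ ± √(pˣˣ/ρ)` (each with multiplicity one). -/
theorem tenMoment_jacobian_charpoly (u : St) (hu : admissible u) :
    (jacF u).charpoly =
      (X - C (vx u)) ^ 2 * ((X - C (vx u)) ^ 2 - C (3 * pxx u / rho u))
        * ((X - C (vx u)) ^ 2 - C (pxx u / rho u)) := by
  have h : u 0 ≠ 0 := ne_of_gt hu.1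
  rw [jacF_eq u h _ _ _ _ _ rfl rfl rfl rfl rfl, charpoly_aux]
  have e1 : 3 * pxx u / rho u = 3 * (u 3 / u 0 - (u 1 / u 0) ^ 2) := by
    simp only [pxx, rho, vx]; field_simp
  have e2 : pxx u / rho u = u 3 / u 0 - (u 1 / u 0) ^ 2 := by
    simp only [pxx, rho, vx]; field_simp
  rw [e1, e2]
  rfl
end
end

section
/- (Second-order accuracy relation for symmetric consistent two-point fluxes.) Let f* : ℝ × ℝ → ℝ be continuously differentiable, symmetric (f*(x,y) = f*(y,x) for all x, y), and consistent with f : ℝ → ℝ in the sense that f*(x,x) = f(x) for all x. Then f is differentiable and for every x, f'(x) = 2 ∂f*/∂y (x, x); equivalently, (∂f*/∂x)(x,x) = (∂f*/∂y)(x,x) = ½ f'(x). -/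
/-- If a two-point numerical flux `f* : ℝ × ℝ → ℝ` is continuously
differentiable, symmetric (`f*(x,y) = f*(y,x)`) and consistent with `f` (`f*(x,x) = f(x)`),
then `f` is differentiable with `f'(x) = 2 ∂f*/∂y (x,x)`; equivalently
`∂f*/∂x (x,x) = ∂f*/∂y (x,x) = ½ f'(x)`. -/
theorem symmetric_consistent_flux_derivative
    (fstar : ℝ × ℝ → ℝ) (f : ℝ → ℝ)
    (hC1 : ContDiff ℝ 1 fstar)
    (hsym : ∀ x y : ℝ, fstar (x, y) = fstar (y, x))
    (hcons : ∀ x : ℝ, fstar (x, x) = f x) (x : ℝ) :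
    HasDerivAt f (2 * fderiv ℝ fstar (x, x) (0, 1)) x ∧
      fderiv ℝ fstar (x, x) (1, 0) = fderiv ℝ fstar (x, x) (0, 1) := by
  have hd : HasFDerivAt fstar (fderiv ℝ fstar (x, x)) (x, x) :=
    (hC1.differentiable (by norm_num) (x, x)).hasFDerivAt
  have h1 : HasDerivAt (fun t : ℝ => fstar (t, x)) (fderiv ℝ fstar (x, x) (1, 0)) x :=
    HasFDerivAt.comp_hasDerivAt (f := fun t : ℝ => (t, x)) x hd
      ((hasDerivAt_id x).prodMk (hasDerivAt_const x x))
  have h2 : HasDerivAt (fun t : ℝ => fstar (x, t)) (fderiv ℝ fstar (x, x) (0, 1)) x :=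
    HasFDerivAt.comp_hasDerivAt (f := fun t : ℝ => (x, t)) x hd
      ((hasDerivAt_const x x).prodMk (hasDerivAt_id x))
  have h3 : HasDerivAt (fun t : ℝ => fstar (t, t)) (fderiv ℝ fstar (x, x) (1, 1)) x :=
    HasFDerivAt.comp_hasDerivAt (f := fun t : ℝ => (t, t)) x hd
      ((hasDerivAt_id x).prodMk (hasDerivAt_id x))
  have e1 : (fun t : ℝ => fstar (t, x)) = fun t => fstar (x, t) := funext fun t => hsym t x
  have e2 : (fun t : ℝ => fstar (t, t)) = f := funext hcons
  rw [e1] at h1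
  have h := h1.unique h2
  refine ⟨?_, h⟩
  have e3 : ((1, 1) : ℝ × ℝ) = (1, 0) + (0, 1) := by simp
  rw [e2, e3, map_add, h, ← two_mul] at h3
  exact h3
end

section
/- (Global semi-discrete entropy stability.) Consider N ≥ 1 elements with widths Δx_i > 0, nodal states u_j^i : I → Ω (0 ≤ j ≤ k, 1 ≤ i ≤ N) evolving by the DG scheme du_j^i/dt + (4/Δx_i) ∑_{l=0}^{k} D_{jl} f*(u_j^i, u_l^i) = (2/Δx_i)(τ_j/ω_j)(f(u_j^i) - f̂_j^i) + s^x(u_j^i), where the SBP matrices satisfy ω_j > 0, S = diag(ω)·D, S + Sᵀ = B = diag(-1,0,...,0,1), rows of D sum to zero; f* is symmetric, consistent and entropy conservative for the entropy U ((v(b)-v(a))·f*(a,b) = ψ(b)-ψ(a)); the interface values are f̂_k^i = f̂_0^{i+1} = f̂(u_k^i, u_0^{i+1}) with periodic identification u^{N+1} = u^1, f̂_j^i = 0 for 0 < j < k; f̂ is entropy stable ((v(u_R)-v(u_L))·f̂(u_L,u_R) ≤ ψ(u_R)-ψ(u_L)); and the sources satisfy v(u)·s^x(u) = 0. Then the total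 entropy is nonincreasing: d/dt ∑_{i=1}^{N} ∑_{j=0}^{k} (Δx_i/2) ω_j U(u_j^i) ≤ 0. -/
/-!
Ten-moment Gaussian closure equations: basic definitions.
Conservative state `u = (ρ, mˣ, mʸ, Eˣˣ, Eˣʸ, Eʸʸ) ∈ ℝ⁶`.
-/

noncomputable section

namespace TenMoment

lemma admissible.detp_pos {a : St} (h : admissible a) : 0 < detp a := by
  have := h.2.det_pos
  simpa [pmat, Matrix.det_fin_two, detp] using this

lemma admissible.differentiableAt {a : St} (h : admissible a) : DifferentiableAt ℝ entU a := by
  have h0 : a 0 ≠ 0 := h.1.ne'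
  have hd := h.detp_pos
  have hne : detp a / (rho a) ^ 4 ≠ 0 := (div_pos hd (pow_pos h.1 4)).ne'
  have hr : DifferentiableAt ℝ rho a := by unfold rho; fun_prop
  have hvx : DifferentiableAt ℝ vx a := by unfold vx; fun_prop (disch := assumption)
  have hvy : DifferentiableAt ℝ vy a := by unfold vy; fun_prop (disch := assumption)
  have h1 : DifferentiableAt ℝ pxx a := by unfold pxx; fun_prop
  have h2 : DifferentiableAt ℝ pxy a := by unfold pxy; fun_prop
  have h3 : DifferentiableAt ℝ pyy a := by unfold pyy; fun_prop
  have h4 : DifferentiableAt ℝ detp a := by unfold detp; fun_prop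
  have h5 : DifferentiableAt ℝ (fun u => detp u / (rho u) ^ 4) a := by
    have h7 : (rho a) ^ 4 ≠ 0 := (pow_pos h.1 4).ne'
    fun_prop (disch := assumption)
  have h6 := h5.log hne
  unfold entU
  exact hr.neg.mul h6

lemma fderiv_eq_dot (a w : St) : fderiv ℝ entU a w = dot (gradU a) w := by
  conv_lhs => rw [pi_eq_sum_univ' w]
  simp only [map_sum, map_smul, dot, gradU, smul_eq_mul]
  exact Finset.sum_congr rfl fun i _ => mul_comm _ _

lemma dot_add (a b c : St) : dot a (b + c) = dot a b + dot a c := by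
  simp [dot, mul_add, Finset.sum_add_distrib]

lemma dot_sub (a b c : St) : dot a (b - c) = dot a b - dot a c := by
  simp [dot, mul_sub, Finset.sum_sub_distrib]

lemma dot_smul (a : St) (r : ℝ) (c : St) : dot a (r • c) = r * dot a c := by
  simp only [dot, Pi.smul_apply, smul_eq_mul, Finset.mul_sum]
  exact Finset.sum_congr rfl fun i _ => by ring

lemma dot_sum {ι : Type*} (s : Finset ι) (a : St) (c : ι → St) :
    dot a (∑ l ∈ s, c l) = ∑ l ∈ s, dot a (c l) := by
  simp only [dot, Finset.sum_apply, Finset.mul_sum]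
  exact Finset.sum_comm

lemma sub_dot (a b c : St) : dot (fun i => a i - b i) c = dot a c - dot b c := by
  simp [dot, sub_mul, Finset.sum_sub_distrib]

/-- Discrete volume identity for an SBP operator and an entropy conservative flux. -/
lemma volume_identity {n : ℕ} (S : Fin n → Fin n → ℝ) (τ : Fin n → ℝ)
    (hS : ∀ j l, S j l + S l j = if j = l then τ j else 0)
    (hrow : ∀ j, ∑ l, S j l = 0)
    (A : Fin n → Fin n → ℝ) (ψ : Fin n → ℝ)
    (hA : ∀ j l, A l j - A j l = ψ l - ψ j) :
    2 * ∑ j, ∑ l, S j l * A j l = ∑ j, τ j * (A j j - ψ j) := by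
  have e1 : ∑ j, ∑ l, S j l * A j l = ∑ j, ∑ l, S l j * A l j := Finset.sum_comm
  have e2 : ∑ j, ∑ l, (S j l + S l j) * A l j = ∑ j, τ j * A j j := by
    simp [hS]
  have e3 : ∑ j, ∑ l, S j l * ψ j = 0 := by
    simp [← Finset.sum_mul, hrow]
  have e4 : ∑ j, ∑ l, S j l * ψ l = ∑ j, τ j * ψ j := by
    have : ∑ j, ∑ l, S j l * ψ l = ∑ j, ∑ l, (S j l + S l j) * ψ j := by
      rw [Finset.sum_comm]
      simp only [add_mul, Finset.sum_add_distrib, e3, zero_add]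
    rw [this]
    simp [hS]
  have e5 : ∑ j, ∑ l, S j l * A j l
      = ∑ j, ∑ l, S j l * A l j - ∑ j, ∑ l, S j l * ψ l + ∑ j, ∑ l, S j l * ψ j := by
    simp only [← Finset.sum_sub_distrib, ← Finset.sum_add_distrib]
    refine Finset.sum_congr rfl fun j _ => Finset.sum_congr rfl fun l _ => ?_
    linear_combination (-S j l) * hA j l
  simp only [add_mul, Finset.sum_add_distrib] at e2
  simp only [mul_sub, Finset.sum_sub_distrib]
  linarith

lemma sum_tau {k : ℕ} (hk : 0 < k) (g : Fin (k + 1) → ℝ) :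
    ∑ j, tau k j * g j = g (Fin.last k) - g 0 := by
  obtain ⟨m, rfl⟩ : ∃ m, k = m + 1 := ⟨k - 1, by omega⟩
  rw [Fin.sum_univ_succ, Fin.sum_univ_castSucc]
  have : ∀ x : Fin m, (x : ℕ) ≠ m := fun x => x.2.ne
  simp [tau, this]
  ring

end TenMoment

open TenMoment in
/-- (Global semi-discrete entropy stability.) For `N+1 ≥ 1` periodic
elements evolving by the entropy stable DG scheme — entropy conservative volume flux `f*`,
entropy stable interface flux `f̂`, entropy-orthogonal source — the total entropy is
nonincreasing in time. -/
theorem esdg_global_entropy_stability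
    (N k : ℕ) (hk : 0 < k)
    (Δx : Fin (N + 1) → ℝ) (hΔx : ∀ i, 0 < Δx i)
    (ω : Fin (k + 1) → ℝ) (hω : ∀ j, 0 < ω j)
    (D : Matrix (Fin (k + 1)) (Fin (k + 1)) ℝ) (hD : ∀ j, ∑ l, D j l = 0)
    (hSBP : Matrix.diagonal ω * D + (Matrix.diagonal ω * D).transpose
      = Matrix.diagonal (tau k))
    (fstar : St → St → St)
    (hsym : ∀ a b, admissible a → admissible b → fstar a b = fstar b a)
    (hcons : ∀ a, admissible a → fstar a a = fluxF a)
    (hEC : ∀ a b, admissible a → admissible b →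
      dot (fun i => gradU b i - gradU a i) (fstar a b) = psiX b - psiX a)
    (fhat : St → St → St)
    (hES : ∀ a b, admissible a → admissible b →
      dot (fun i => gradU b i - gradU a i) (fhat a b) ≤ psiX b - psiX a)
    (Wx : ℝ → ℝ)
    (hsrc : ∀ t a, admissible a → dot (gradU a) (srcX (Wx t) a) = 0)
    (u u' : Fin (N + 1) → Fin (k + 1) → ℝ → St)
    (hadm : ∀ i j t, admissible (u i j t))
    (hderiv : ∀ i j t, HasDerivAt (u i j) (u' i j t) t)
    (hscheme : ∀ i j t,
      u' i j t + (4 / Δx i) • ∑ l, D j l • fstar (u i j t) (u i l t)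
        = ((2 / Δx i) * (tau k j / ω j)) •
            (fluxF (u i j t) -
              (if (j : ℕ) = 0 then fhat (u (i - 1) (Fin.last k) t) (u i 0 t)
               else if (j : ℕ) = k then fhat (u i (Fin.last k) t) (u (i + 1) 0 t) else 0))
          + srcX (Wx t) (u i j t))
    (t : ℝ) :
    deriv (fun s => ∑ i, ∑ j, (Δx i / 2 * ω j) * entU (u i j s)) t ≤ 0 := by
  set v : Fin (N + 1) → Fin (k + 1) → St := fun i j => gradU (u i j t) with hv
  have hder : HasDerivAt (fun s => ∑ i, ∑ j, (Δx i / 2 * ω j) * entU (u i j s))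
      (∑ i, ∑ j, (Δx i / 2 * ω j) * dot (v i j) (u' i j t)) t := by
    refine HasDerivAt.fun_sum fun i _ => HasDerivAt.fun_sum fun j _ => ?_
    have h := ((hadm i j t).differentiableAt.hasFDerivAt).comp_hasDerivAt t (hderiv i j t)
    rw [fderiv_eq_dot] at h
    exact h.const_mul _
  rw [hder.deriv]
  have hSent : ∀ j l, ω j * D j l + ω l * D l j = if j = l then tau k j else 0 := by
    intro j l
    have := congrFun (congrFun hSBP j) l
    simpa [Matrix.diagonal_mul, Matrix.diagonal_apply, mul_comm] using this
  -- interface flux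
  set g : Fin (N + 1) → Fin (k + 1) → St := fun i j =>
    (if (j : ℕ) = 0 then fhat (u (i - 1) (Fin.last k) t) (u i 0 t)
      else if (j : ℕ) = k then fhat (u i (Fin.last k) t) (u (i + 1) 0 t) else 0) with hg
  have hnode : ∀ i j, (Δx i / 2 * ω j) * dot (v i j) (u' i j t)
      = tau k j * (dot (v i j) (fluxF (u i j t)) - dot (v i j) (g i j))
        - 2 * ∑ l, (ω j * D j l) * dot (v i j) (fstar (u i j t) (u i l t)) := by
    intro i j
    have h := congrArg (dot (v i j)) (hscheme i j t)
    rw [dot_add, dot_add, dot_smul, dot_smul, dot_sub, dot_sum, hsrc t _ (hadm i j t)] at h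
    simp only [dot_smul] at h
    have h' : dot (v i j) (u' i j t)
        = (2 / Δx i) * (tau k j / ω j) * (dot (v i j) (fluxF (u i j t)) - dot (v i j) (g i j))
          - (4 / Δx i) * ∑ l, D j l * dot (v i j) (fstar (u i j t) (u i l t)) := by
      linarith
    have hx := (hΔx i).ne'
    have hw := (hω j).ne'
    rw [h']
    simp only [mul_assoc (ω j), ← Finset.mul_sum]
    field_simp
    ring
  have helem : ∀ i, ∑ j, (Δx i / 2 * ω j) * dot (v i j) (u' i j t)
      = (psiX (u i (Fin.last k) t)
          - dot (v i (Fin.last k)) (fhat (u i (Fin.last k) t) (u (i + 1) 0 t)))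
        - (psiX (u i 0 t) - dot (v i 0) (fhat (u (i - 1) (Fin.last k) t) (u i 0 t))) := by
    intro i
    have hvol := volume_identity (fun j l => ω j * D j l) (tau k) hSent
      (fun j => by rw [← Finset.mul_sum, hD, mul_zero])
      (fun j l => dot (v i j) (fstar (u i j t) (u i l t))) (fun j => psiX (u i j t))
      (fun j l => by
        have := hEC _ _ (hadm i j t) (hadm i l t)
        rw [sub_dot] at this
        rw [hsym _ _ (hadm i l t) (hadm i j t)]
        exact this)
    simp only [hnode, Finset.sum_sub_distrib, ← Finset.mul_sum]
    rw [hvol, ← Finset.sum_sub_distrib]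
    have : ∀ j, tau k j * (dot (v i j) (fluxF (u i j t)) - dot (v i j) (g i j))
        - tau k j * (dot (v i j) (fstar (u i j t) (u i j t)) - psiX (u i j t))
        = tau k j * (psiX (u i j t) - dot (v i j) (g i j)) := by
      intro j
      rw [hcons _ (hadm i j t)]
      ring
    simp only [this]
    rw [sum_tau hk (fun j => psiX (u i j t) - dot (v i j) (g i j))]
    simp [hg, hk.ne']
  simp only [helem]
  rw [Finset.sum_sub_distrib]
  have hshift : ∑ i, (psiX (u i 0 t)
        - dot (v i 0) (fhat (u (i - 1) (Fin.last k) t) (u i 0 t)))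
      = ∑ i, (psiX (u (i + 1) 0 t)
        - dot (v (i + 1) 0) (fhat (u i (Fin.last k) t) (u (i + 1) 0 t))) := by
    rw [← Equiv.sum_comp (Equiv.addRight (1 : Fin (N + 1)))]
    simp
  rw [hshift, ← Finset.sum_sub_distrib]
  refine Finset.sum_nonpos fun i _ => ?_
  have := hES _ _ (hadm i (Fin.last k) t) (hadm (i + 1) 0 t)
  rw [sub_dot] at this
  simp only [hv]
  linarith
end
end

section
/- (Entropy conservation property of the ten-moment EC flux.) Let f* : Ω × Ω → ℝ⁶ be the two-point flux defined via logarithmic and arithmetic means: f*₁ = ρ^{ln} v̄^x, f*₂ = f*₁ v̄^x + ρ̄ β̄_{xx}/(β̄_{xx}β̄_{yy} - β̄_{xy}²), f*₃ = f*₁ v̄^y + ρ̄ β̄_{xy}/(β̄_{xx}β̄_{yy} - β̄_{xy}²), f*₄ = (β̄_{xx}/D_β^{ln} - \overline{(v^x)²}) f*₁ + 2 v̄^x f*₂, f*₅ = (β̄_{xy}/D_β^{ln} - \overline{v^x v^y}) f*₁ + v̄^x f*₃ + v̄^y f*₂, f*₆ = (β̄_{yy}/D_β^{ln} - \overline{(v^y)²})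 f*₁ + 2 v̄^y f*₃. Then for all u_L, u_R ∈ Ω, f* satisfies the entropy conservation condition (v(u_R) - v(u_L)) · f*(u_L, u_R) = ψ(u_R) - ψ(u_L) = 2ρ_R v^x_R - 2ρ_L v^x_L, where v(u) = ∇_u U(u) is the entropy variable of U(u) = -ρ ln(det p/ρ⁴) and ψ(u) = 2ρ v^x is the entropy potential. -/
/-!
Ten-moment Gaussian closure equations: basic definitions.
Conservative state `u = (ρ, mˣ, mʸ, Eˣˣ, Eˣʸ, Eʸʸ) ∈ ℝ⁶`.
-/

noncomputable section

namespace TenMoment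

/-- Positivity facts for an admissible state. -/
lemma admissible_pos {u : St} (h : admissible u) :
    0 < rho u ∧ 0 < pxx u ∧ 0 < detp u := by
  refine ⟨h.1, ?_, ?_⟩
  · have := h.2.diag_pos (i := 0)
    simpa [pmat] using this
  · have := h.2.det_pos
    simpa [pmat, Matrix.det_fin_two, detp] using this

lemma logMean_pos {a b : ℝ} (ha : 0 < a) (hb : 0 < b) : 0 < logMean a b := by
  unfold logMean
  split_ifs with h
  · exact ha
  · rcases lt_or_gt_of_ne h with h | h
    · exact div_pos (sub_pos.2 h) (sub_pos.2 (Real.log_lt_log ha h))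
    · exact div_pos_of_neg_of_neg (sub_neg.2 h) (sub_neg.2 (Real.log_lt_log hb h))

lemma logMean_mul {a b : ℝ} (ha : 0 < a) (hb : 0 < b) :
    logMean a b * (Real.log b - Real.log a) = b - a := by
  unfold logMean
  split_ifs with h
  · simp [h]
  · have : Real.log b - Real.log a ≠ 0 := by
      intro h'
      exact h (Real.log_injOn_pos ha hb (sub_eq_zero.1 h').symm)
    field_simp

lemma Db_eq {u : St} (h : admissible u) : Db u = rho u ^ 2 / detp u := by
  obtain ⟨h0, h1, h2⟩ := admissible_pos h
  have e : detp u = pxx u * pyy u - pxy u * pxy u := rfl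
  have h2' := h2.ne'
  unfold Db bxx bxy byy Dq
  field_simp
  rw [e]; ring

lemma log_eq {u : St} (h : admissible u) :
    Real.log (detp u / rho u ^ 4) = - Real.log (Db u) - 2 * Real.log (rho u) := by
  obtain ⟨h0, h1, h2⟩ := admissible_pos h
  rw [Db_eq h, Real.log_div h2.ne' (by positivity), Real.log_div (by positivity) h2.ne',
    Real.log_pow, Real.log_pow]
  push_cast; ring

/-- The entropy variables written in terms of `β`. -/
lemma gradU_eq {u : St} (h : admissible u) : gradU u =
    ![4 + Real.log (Db u) + 2 * Real.log (rho u)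
        - (byy u * vx u ^ 2 - 2 * bxy u * vx u * vy u + bxx u * vy u ^ 2),
      2 * (byy u * vx u - bxy u * vy u),
      2 * (bxx u * vy u - bxy u * vx u),
      - byy u, 2 * bxy u, - bxx u] := by
  obtain ⟨h0, h1, h2⟩ := admissible_pos h
  have hr : u 0 ≠ 0 := h0.ne'
  have hpr (i : Fin 6) : HasFDerivAt (fun w : St => w i)
      (ContinuousLinearMap.proj (R := ℝ) (φ := fun _ : Fin 6 => ℝ) i) u :=
    (ContinuousLinearMap.proj (R := ℝ) (φ := fun _ : Fin 6 => ℝ) i).hasFDerivAt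
  have hinv : HasFDerivAt (fun w : St => (w 0)⁻¹) _ u :=
    (hasDerivAt_inv hr).comp_hasFDerivAt u (hpr 0)
  have hvx : HasFDerivAt vx _ u := (hpr 1).mul hinv
  have hvy : HasFDerivAt vy _ u := (hpr 2).mul hinv
  have hpxx : HasFDerivAt pxx _ u := (hpr 3).sub (((hpr 0).mul hvx).mul hvx)
  have hpxy : HasFDerivAt pxy _ u := (hpr 4).sub (((hpr 0).mul hvx).mul hvy)
  have hpyy : HasFDerivAt pyy _ u := (hpr 5).sub (((hpr 0).mul hvy).mul hvy)
  have hdet : HasFDerivAt detp _ u := (hpxx.mul hpyy).sub (hpxy.mul hpxy)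
  have hl1 : HasFDerivAt (fun w => Real.log (detp w)) _ u := hdet.log h2.ne'
  have hl0 : HasFDerivAt (fun w : St => Real.log (w 0)) _ u := (hpr 0).log hr
  have hU : HasFDerivAt (fun w : St => - w 0 * (Real.log (detp w) - 4 * Real.log (w 0))) _ u :=
    (hpr 0).neg.mul (hl1.sub (hl0.const_mul 4))
  have hev : entU =ᶠ[nhds u] fun w => - w 0 * (Real.log (detp w) - 4 * Real.log (w 0)) := by
    have c1 : ∀ᶠ w in nhds u, detp w ≠ 0 := hdet.continuousAt.eventually_ne h2.ne'
    have c2 : ∀ᶠ w : St in nhds u, w 0 ≠ 0 := (hpr 0).continuousAt.eventually_ne hr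
    filter_upwards [c1, c2] with w w1 w2
    unfold entU rho
    rw [Real.log_div w1 (pow_ne_zero _ w2), Real.log_pow]
    push_cast; ring
  have hF := (hU.congr_of_eventuallyEq hev).fderiv
  have hlog : Real.log (detp u) - 4 * Real.log (u 0)
      = - Real.log (Db u) - 2 * Real.log (rho u) := by
    rw [← log_eq h, Real.log_div h2.ne' (by positivity), Real.log_pow]
    push_cast; rfl
  have e : detp u = pxx u * pyy u - pxy u * pxy u := rfl
  have e1 : u 1 = u 0 * vx u := by unfold vx; field_simp
  have e2 : u 2 = u 0 * vy u := by unfold vy; field_simp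
  have h2' := h2.ne'
  have hd : Dq u = detp u / u 0 := rfl
  funext i
  unfold gradU
  rw [hF]
  rw [hlog]
  fin_cases i <;> simp [bxx, bxy, byy, hd, rho, e1, e2] <;> field_simp <;>
    (try rw [e]) <;> ring

lemma psiX_eq {u : St} (h : admissible u) : psiX u = 2 * rho u * vx u := by
  obtain ⟨h0, h1, h2⟩ := admissible_pos h
  have h2' := h2.ne'
  have e : detp u = pxx u * pyy u - pxy u * pxy u := rfl
  unfold psiX dot
  rw [gradU_eq h]
  unfold entF fluxF
  rw [log_eq h]
  simp [Fin.sum_univ_succ, bxx, bxy, byy, Dq]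
  field_simp
  rw [e]; ring

lemma b_pos {u : St} (h : admissible u) : 0 < bxx u ∧ 0 < Db u := by
  obtain ⟨h0, h1, h2⟩ := admissible_pos h
  refine ⟨?_, ?_⟩
  · unfold bxx Dq; positivity
  · rw [Db_eq h]; positivity

/-- The sum of two positive definite symmetric 2×2 tensors has positive determinant. -/
lemma det_add_pos {a b c a' b' c' : ℝ} (ha : 0 < a) (h : 0 < a * c - b ^ 2)
    (ha' : 0 < a') (h' : 0 < a' * c' - b' ^ 2) : 0 < (a + a') * (c + c') - (b + b') ^ 2 := by
  have key : a * a' * ((a + a') * (c + c') - (b + b') ^ 2)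
      = a' * (a + a') * (a * c - b ^ 2) + a * (a + a') * (a' * c' - b' ^ 2)
        + (a' * b - a * b') ^ 2 := by ring
  have : 0 < a * a' * ((a + a') * (c + c') - (b + b') ^ 2) := by rw [key]; positivity
  exact pos_of_mul_pos_right this (by positivity)

lemma dot_eq {uL uR : St} (hL : admissible uL) (hR : admissible uR) :
    dot (fun i => gradU uR i - gradU uL i) (fstarEC uL uR)
      = 2 * rho uR * vx uR - 2 * rho uL * vx uL := by
  have pL := b_pos hL
  have pR := b_pos hR
  have hq := det_add_pos pL.1 pL.2 pR.1 pR.2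
  have hr := logMean_mul hL.1 hR.1
  have hd := logMean_mul pL.2 pR.2
  have hd0 := (logMean_pos pL.2 pR.2).ne'
  have hq' : avg (bxx uL) (bxx uR) * avg (byy uL) (byy uR) - avg (bxy uL) (bxy uR) ^ 2 ≠ 0 := by
    unfold avg
    intro h0
    apply hq.ne'
    linear_combination 4 * h0
  have hd2 : Real.log (Db uR) = Real.log (Db uL) + (Db uR - Db uL) / logMean (Db uL) (Db uR) := by
    rw [← hd]; field_simp; ring
  unfold dot
  rw [gradU_eq hL, gradU_eq hR]
  simp only [Fin.sum_univ_succ, fstarEC]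
  simp
  rw [hd2]
  generalize logMean (Db uL) (Db uR) = d at *
  generalize logMean (rho uL) (rho uR) = r at *
  generalize hQ : avg (bxx uL) (bxx uR) * avg (byy uL) (byy uR) - avg (bxy uL) (bxy uR) ^ 2 = Q at *
  have hQ2 : Q * Q⁻¹ = 1 := mul_inv_cancel₀ hq'
  simp only [div_eq_mul_inv _ Q, div_eq_mul_inv _ d]
  generalize Q⁻¹ = q at *
  rw [← hQ] at hQ2
  generalize d⁻¹ = e at *
  simp only [Db, avg] at hQ2 ⊢
  linear_combination (vx uL + vx uR) * hr + (rho uL + rho uR) * (vx uR - vx uL) * hQ2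

end TenMoment

open TenMoment in
/-- (Entropy conservation property of the ten-moment EC flux.) For all
admissible states `u_L, u_R ∈ Ω`, the Sen–Kumar two-point flux `f*` satisfies
`(v(u_R) - v(u_L)) · f*(u_L,u_R) = ψ(u_R) - ψ(u_L) = 2ρ_R vˣ_R - 2ρ_L vˣ_L`,
where `v(u) = ∇ᵤU(u)` and `ψ(u) = v(u)·f(u) - F(u)` is the entropy potential. -/
theorem tenMoment_ec_flux_entropy_conservative
    (uL uR : St) (hL : admissible uL) (hR : admissible uR) :
    dot (fun i => gradU uR i - gradU uL i) (fstarEC uL uR) = psiX uR - psiX uL ∧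
      psiX uR - psiX uL = 2 * rho uR * vx uR - 2 * rho uL * vx uL := by
  rw [psiX_eq hL, psiX_eq hR]
  exact ⟨dot_eq hL hR, rfl⟩
end
end
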